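/- arXiv:1704.00589 — 2 statements merged into one kernel-verified Lean document; each statement's English description precedes it below -/
import Mathlib

section
/- Let c be a normalized Hochschild 2-cocycle with trivial coefficients on A_s(n,d). Then for every index i: c(u_{ii}, u_{ii}) = (1/2) Σ_{j=1}^n c(u_{ij}, u_{ij}) = (1/2) Σ_{j=1}^n c(u_{ji}, u_{ji}). -/
open scoped BigOperators

/-- The relations presenting the quantum permutation algebra `A_s(n,d)`. -/
inductive ASRel (n : ℕ) (d : Matrix (Fin n) (Fin n) ℂ) :
    FreeAlgebra ℂ (Fin n × Fin n) → FreeAlgebra ℂ (Fin n × Fin n) → Prop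
  | row_orth (i j k : Fin n) :
      ASRel n d (FreeAlgebra.ι ℂ (i, j) * FreeAlgebra.ι ℂ (i, k))
        (if j = k then FreeAlgebra.ι ℂ (i, j) else 0)
  | col_orth (i j k : Fin n) :
      ASRel n d (FreeAlgebra.ι ℂ (j, i) * FreeAlgebra.ι ℂ (k, i))
        (if j = k then FreeAlgebra.ι ℂ (j, i) else 0)
  | row_sum (i : Fin n) : ASRel n d (∑ j, FreeAlgebra.ι ℂ (i, j)) 1
  | col_sum (i : Fin n) : ASRel n d (∑ j, FreeAlgebra.ι ℂ (j, i)) 1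
  | inter (i j : Fin n) :
      ASRel n d (∑ k, d i k • FreeAlgebra.ι ℂ (k, j)) (∑ k, d k j • FreeAlgebra.ι ℂ (i, k))

/-- The quantum permutation algebra `A_s(n,d)`. -/
abbrev ASAlg (n : ℕ) (d : Matrix (Fin n) (Fin n) ℂ) := RingQuot (ASRel n d)

/-- The generators `u_{ij}` of `A_s(n,d)`. -/
noncomputable def ASu {n : ℕ} (d : Matrix (Fin n) (Fin n) ℂ) (i j : Fin n) : ASAlg n d :=
  RingQuot.mkAlgHom ℂ (ASRel n d) (FreeAlgebra.ι ℂ (i, j))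

/-- The counit `ε : A_s(n,d) → ℂ`, the unique algebra map with `ε(u_{ij}) = δ_{ij}`. -/
noncomputable def ASeps (n : ℕ) (d : Matrix (Fin n) (Fin n) ℂ) : ASAlg n d →ₐ[ℂ] ℂ :=
  RingQuot.liftAlgHom ℂ
    ⟨FreeAlgebra.lift ℂ (fun p => if p.1 = p.2 then (1 : ℂ) else 0), by
      intro a b h
      induction h with
      | row_orth i j k =>
          simp only [map_mul, FreeAlgebra.lift_ι_apply, apply_ite, map_zero]
          split_ifs <;> simp_all
      | col_orth i j k =>
          simp only [map_mul, FreeAlgebra.lift_ι_apply, apply_ite, map_zero]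
          split_ifs <;> simp_all
      | row_sum i =>
          simp [FreeAlgebra.lift_ι_apply]
      | col_sum i =>
          simp [FreeAlgebra.lift_ι_apply]
      | inter i j =>
          simp [FreeAlgebra.lift_ι_apply, smul_ite]⟩

lemma ASeps_u {n : ℕ} (d : Matrix (Fin n) (Fin n) ℂ) (i j : Fin n) :
    ASeps n d (ASu d i j) = if i = j then 1 else 0 := by
  simp [ASeps, ASu, RingQuot.liftAlgHom_mkAlgHom_apply, FreeAlgebra.lift_ι_apply]

section

variable {A : Type*} [Ring A] [Algebra ℂ A]

/-- A normalized 2-cocycle with trivial coefficients vanishes when its second argument is `1`. -/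
lemma cocycle_apply_one {ε : A →ₐ[ℂ] ℂ} {c : A →ₗ[ℂ] A →ₗ[ℂ] ℂ}
    (hc : ∀ a b x : A, ε a * c b x - c (a * b) x + c a (b * x) - c a b * ε x = 0)
    (h1 : c 1 1 = 0) (a : A) : c a 1 = 0 := by
  have h := hc a 1 1
  simp only [h1, mul_one, map_one, mul_zero] at h
  linear_combination -h

/-- For a partition of unity by orthogonal idempotents on which the augmentation is concentrated
at the index `i`, the diagonal values of a normalized 2-cocycle sum to twice the value at `i`. -/
lemma cocycle_partition_of_unity {ι : Type*} [Fintype ι] [DecidableEq ι]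
    {ε : A →ₐ[ℂ] ℂ} {c : A →ₗ[ℂ] A →ₗ[ℂ] ℂ}
    (hc : ∀ a b x : A, ε a * c b x - c (a * b) x + c a (b * x) - c a b * ε x = 0)
    (h1 : c 1 1 = 0) (p : ι → A) (i : ι)
    (horth : ∀ j k, p j * p k = if j = k then p j else 0) (hsum : ∑ j, p j = 1)
    (hε : ∀ j, ε (p j) = if i = j then 1 else 0) :
    c (p i) (p i) = (1 / 2 : ℂ) * ∑ j, c (p j) (p j) := by
  have hoff : ∀ j ∈ Finset.univ.erase i, c (p i) (p j) = -c (p j) (p j) := by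
    intro j hj
    have hij : i ≠ j := (Finset.ne_of_mem_erase hj).symm
    have h := hc (p i) (p j) (p j)
    simp only [horth, hε, if_neg hij, if_true, map_zero, LinearMap.zero_apply] at h
    linear_combination h
  have h0 : ∑ j, c (p i) (p j) = 0 := by
    rw [← map_sum, hsum, cocycle_apply_one hc h1]
  rw [← Finset.add_sum_erase _ _ (Finset.mem_univ i), Finset.sum_congr rfl hoff,
    Finset.sum_neg_distrib] at h0
  rw [← Finset.add_sum_erase _ _ (Finset.mem_univ i)]
  linear_combination (1 / 2 : ℂ) * h0

end

section

variable {n : ℕ} (d : Matrix (Fin n) (Fin n) ℂ)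

lemma ASu_row_orth (i j k : Fin n) :
    ASu d i j * ASu d i k = if j = k then ASu d i j else 0 := by
  simpa only [ASu, map_mul, apply_ite (RingQuot.mkAlgHom ℂ (ASRel n d)), map_zero] using
    RingQuot.mkAlgHom_rel ℂ (ASRel.row_orth (d := d) i j k)

lemma ASu_col_orth (i j k : Fin n) :
    ASu d j i * ASu d k i = if j = k then ASu d j i else 0 := by
  simpa only [ASu, map_mul, apply_ite (RingQuot.mkAlgHom ℂ (ASRel n d)), map_zero] using
    RingQuot.mkAlgHom_rel ℂ (ASRel.col_orth (d := d) i j k)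

lemma ASu_row_sum (i : Fin n) : ∑ j, ASu d i j = 1 := by
  simpa only [ASu, map_sum, map_one] using RingQuot.mkAlgHom_rel ℂ (ASRel.row_sum (d := d) i)

lemma ASu_col_sum (i : Fin n) : ∑ j, ASu d j i = 1 := by
  simpa only [ASu, map_sum, map_one] using RingQuot.mkAlgHom_rel ℂ (ASRel.col_sum (d := d) i)

end

/-- Item (6) of Lemma 5.2: for a normalized Hochschild 2-cocycle `c` with
trivial coefficients on `A_s(n,d)`,
`c(u_{ii}, u_{ii}) = (1/2) Σ_j c(u_{ij}, u_{ij}) = (1/2) Σ_j c(u_{ji}, u_{ji})`. -/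
theorem cocycle_diagonal_sum (n : ℕ) (hn : 1 ≤ n) (d : Matrix (Fin n) (Fin n) ℂ)
    (c : ASAlg n d →ₗ[ℂ] ASAlg n d →ₗ[ℂ] ℂ)
    (hcocycle : ∀ a b x : ASAlg n d,
      ASeps n d a * c b x - c (a * b) x + c a (b * x) - c a b * ASeps n d x = 0)
    (hnorm : c 1 1 = 0) :
    ∀ i : Fin n,
      c (ASu d i i) (ASu d i i) = (1 / 2 : ℂ) * ∑ j, c (ASu d i j) (ASu d i j)
      ∧ c (ASu d i i) (ASu d i i) = (1 / 2 : ℂ) * ∑ j, c (ASu d j i) (ASu d j i) := by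
  intro i
  exact ⟨cocycle_partition_of_unity hcocycle hnorm (fun j => ASu d i j) i
      (ASu_row_orth d i) (ASu_row_sum d i) (ASeps_u d i),
    cocycle_partition_of_unity hcocycle hnorm (fun j => ASu d j i) i
      (ASu_col_orth d i) (ASu_col_sum d i) fun j => by simp only [ASeps_u, eq_comm]⟩
end

section
/- Let c be a normalized Hochschild 2-cocycle with trivial coefficients on A_s(n,d), and for indices i, j set X_{ij} = Σ_{k=1}^n d_{ik} u_{kj} (which equals Σ_{k=1}^n u_{ik} d_{kj} in A_s(n,d)). Then c(u_{ii}, X_{ij}) = c(X_{ij}, u_{ii}) = c(X_{ij}, u_{jj}) = c(u_{jj}, X_{ij}). -/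
open scoped BigOperators

lemma ASu_row_mul {n : ℕ} (d : Matrix (Fin n) (Fin n) ℂ) (i j k : Fin n) :
    ASu d i j * ASu d i k = if j = k then ASu d i j else 0 := by
  have h := RingQuot.mkAlgHom_rel ℂ (ASRel.row_orth (d := d) i j k)
  rwa [map_mul, apply_ite (RingQuot.mkAlgHom ℂ (ASRel n d)), map_zero] at h

lemma ASu_col_mul {n : ℕ} (d : Matrix (Fin n) (Fin n) ℂ) (i j k : Fin n) :
    ASu d j i * ASu d k i = if j = k then ASu d j i else 0 := by
  have h := RingQuot.mkAlgHom_rel ℂ (ASRel.col_orth (d := d) i j k)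
  rwa [map_mul, apply_ite (RingQuot.mkAlgHom ℂ (ASRel n d)), map_zero] at h

lemma ASu_inter {n : ℕ} (d : Matrix (Fin n) (Fin n) ℂ) (i j : Fin n) :
    ∑ k, d i k • ASu d k j = ∑ k, d k j • ASu d i k := by
  have h := RingQuot.mkAlgHom_rel ℂ (ASRel.inter (d := d) i j)
  simpa only [map_sum, map_smul, ASu] using h

/-- If `p * x = t • p` and `x * q = t • q` with `ε p = ε q = 1`, then every Hochschild
2-cocycle with trivial coefficients satisfies `c(x, q) = c(p, x)`. -/
lemma cocycle_apply_eq_of_mul_eq_smul {A : Type*} [Ring A] [Algebra ℂ A] (ε : A →ₐ[ℂ] ℂ)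
    (c : A →ₗ[ℂ] A →ₗ[ℂ] ℂ)
    (hc : ∀ a b x : A, ε a * c b x - c (a * b) x + c a (b * x) - c a b * ε x = 0)
    {p q x : A} {t : ℂ} (hp : ε p = 1) (hq : ε q = 1)
    (hpx : p * x = t • p) (hxq : x * q = t • q) : c x q = c p x := by
  have h := hc p x q
  simp only [hp, hq, hpx, hxq, map_smul, LinearMap.smul_apply] at h
  linear_combination h

/-- Item (8) of Lemma 5.2: with `X_{ij} = Σ_k d_{ik} u_{kj}`
(which equals `Σ_k u_{ik} d_{kj}` in `A_s(n,d)`), a normalized Hochschild 2-cocycle `c`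
with trivial coefficients satisfies
`c(u_{ii}, X_{ij}) = c(X_{ij}, u_{ii}) = c(X_{ij}, u_{jj}) = c(u_{jj}, X_{ij})`. -/
theorem cocycle_X_identities (n : ℕ) (hn : 1 ≤ n) (d : Matrix (Fin n) (Fin n) ℂ)
    (c : ASAlg n d →ₗ[ℂ] ASAlg n d →ₗ[ℂ] ℂ)
    (hcocycle : ∀ a b x : ASAlg n d,
      ASeps n d a * c b x - c (a * b) x + c a (b * x) - c a b * ASeps n d x = 0)
    (hnorm : c 1 1 = 0) :
    ∀ i j : Fin n,
      (∑ k, d i k • ASu d k j) = (∑ k, d k j • ASu d i k)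
      ∧ c (ASu d i i) (∑ k, d i k • ASu d k j) = c (∑ k, d i k • ASu d k j) (ASu d i i)
      ∧ c (∑ k, d i k • ASu d k j) (ASu d i i) = c (∑ k, d i k • ASu d k j) (ASu d j j)
      ∧ c (∑ k, d i k • ASu d k j) (ASu d j j) = c (ASu d j j) (∑ k, d i k • ASu d k j) := by
  intro i j
  have hε (k : Fin n) : ASeps n d (ASu d k k) = 1 := by simp [ASeps_u]
  have hiX : ASu d i i * ∑ k, d i k • ASu d k j = d i j • ASu d i i := by
    simp [ASu_inter, Finset.mul_sum, ASu_row_mul]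
  have hXi : (∑ k, d i k • ASu d k j) * ASu d i i = d i j • ASu d i i := by
    simp [ASu_inter, Finset.sum_mul, ASu_row_mul]
  have hjX : ASu d j j * ∑ k, d i k • ASu d k j = d i j • ASu d j j := by
    simp [Finset.mul_sum, ASu_col_mul]
  have hXj : (∑ k, d i k • ASu d k j) * ASu d j j = d i j • ASu d j j := by
    simp [Finset.sum_mul, ASu_col_mul]
  have hii := cocycle_apply_eq_of_mul_eq_smul _ c hcocycle (hε i) (hε i) hiX hXi
  have hij := cocycle_apply_eq_of_mul_eq_smul _ c hcocycle (hε i) (hε j) hiX hXj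
  have hjj := cocycle_apply_eq_of_mul_eq_smul _ c hcocycle (hε j) (hε j) hjX hXj
  exact ⟨ASu_inter d i j, hii.symm, hii.trans hij.symm, hjj⟩
end
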